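/- Suppose g satisfies the Hölderian error bound with r = 1 (weak sharpness). Run the AGM-BiO iteration with step sizes a_k = γ(k+1)/(4 L_f) where 0 < γ ≤ min{ 2 α L_f / (2 M L_g + α L_f), 1 } and M = max_{x ∈ X_g*} ‖∇f(x)‖. Then for every k ≥ 1, f(x_k) − f(x*) ≥ − C_g M (ln k + 1) / (α k(k+1)) − C_f / (γ k(k+1)), where C_f = 4 L_f ‖x_0 − x*‖² and C_g = 8 L_g ‖x_0 − x*‖². -/

import Mathlib

open RealInnerProductSpace

section Smooth

variable {E : Type*} [NormedAddCommGroup E] [InnerProductSpace ℝ E]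

/-- The restriction of a differentiable function to a line. -/
theorem HasGradientAt.hasDerivAt_comp_line [CompleteSpace E] {h : E → ℝ} {h' : E → E}
    (hh : ∀ w, HasGradientAt h (h' w) w) (u d : E) (t : ℝ) :
    HasDerivAt (fun s : ℝ => h (u + s • d)) ⟪h' (u + t • d), d⟫ t := by
  have hline : HasDerivAt (fun s : ℝ => u + s • d) d t := by
    simpa using ((hasDerivAt_id t).smul_const d).const_add u
  simpa [Function.comp_def] using
    (hh (u + t • d)).hasFDerivAt.comp_hasDerivAt t hline

/-- First-order characterization of convexity. -/
theorem ConvexOn.add_inner_gradient_le [CompleteSpace E] {h : E → ℝ} {h' : E → E}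
    (hc : ConvexOn ℝ Set.univ h) (hh : ∀ w, HasGradientAt h (h' w) w) (u v : E) :
    h u + ⟪h' u, v - u⟫ ≤ h v := by
  have hcl : ConvexOn ℝ Set.univ (fun s : ℝ => h (u + s • (v - u))) := by
    have := hc.comp_affineMap (AffineMap.lineMap u v : ℝ →ᵃ[ℝ] E)
    simpa [Function.comp_def, AffineMap.lineMap_apply, add_comm] using this
  have hd := HasGradientAt.hasDerivAt_comp_line hh u (v - u) 0
  have := hcl.le_slope_of_hasDerivAt (Set.mem_univ 0) (Set.mem_univ 1) one_pos hd
  simp [slope_def_field] at this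
  linarith

/-- The descent lemma for functions with Lipschitz gradient. -/
theorem le_add_inner_gradient_add_sq [CompleteSpace E] {h : E → ℝ} {h' : E → E} {L : ℝ}
    (hh : ∀ w, HasGradientAt h (h' w) w) (hL : ∀ u v, ‖h' u - h' v‖ ≤ L * ‖u - v‖) (u v : E) :
    h v ≤ h u + ⟪h' u, v - u⟫ + L / 2 * ‖v - u‖ ^ 2 := by
  set d := v - u with hd
  let φ : ℝ → ℝ := fun s => h (u + s • d) - s * ⟪h' u, d⟫ - s ^ 2 * (L / 2 * ‖d‖ ^ 2)
  have hφ : ∀ t, HasDerivAt φ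
      (⟪h' (u + t • d), d⟫ - ⟪h' u, d⟫ - 2 * t * (L / 2 * ‖d‖ ^ 2)) t := fun t => by
    have h1 := (hasDerivAt_id t).mul_const ⟪h' u, d⟫
    have h2 := (hasDerivAt_pow 2 t).mul_const (L / 2 * ‖d‖ ^ 2)
    exact (((HasGradientAt.hasDerivAt_comp_line hh u d t).sub h1).sub h2).congr_deriv (by simp)
  have hanti : AntitoneOn φ (Set.Icc 0 1) := by
    refine antitoneOn_of_deriv_nonpos (convex_Icc 0 1)
      (fun t _ => (hφ t).continuousAt.continuousWithinAt)
      (fun t _ => (hφ t).differentiableAt.differentiableWithinAt) fun t ht => ?_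
    rw [interior_Icc] at ht
    have hnorm : ‖h' (u + t • d) - h' u‖ ≤ L * (t * ‖d‖) := by
      simpa [norm_smul, abs_of_pos ht.1] using hL (u + t • d) u
    have hin := (real_inner_le_norm (h' (u + t • d) - h' u) d).trans
      (mul_le_mul_of_nonneg_right hnorm (norm_nonneg d))
    rw [inner_sub_left] at hin
    rw [(hφ t).deriv]
    linarith
  have := hanti (Set.left_mem_Icc.2 zero_le_one) (Set.right_mem_Icc.2 zero_le_one) zero_le_one
  simp [φ, hd] at this
  linarith

/-- Variational inequality for a Euclidean projection onto a convex set. -/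
theorem inner_sub_le_zero_of_norm_sub_le {K : Set E} (hK : Convex ℝ K) {u v w : E}
    (hv : v ∈ K) (hmin : ∀ w ∈ K, ‖v - u‖ ≤ ‖w - u‖) (hw : w ∈ K) : ⟪u - v, w - v⟫ ≤ 0 := by
  have : Nonempty K := ⟨⟨v, hv⟩⟩
  refine (norm_eq_iInf_iff_real_inner_le_zero hK hv).1 (le_antisymm ?_ ?_) w hw
  · exact le_ciInf fun p => by
      rw [norm_sub_rev u v, norm_sub_rev u p]
      exact hmin p p.2
  · exact ciInf_le ⟨0, Set.forall_mem_range.2 fun _ => norm_nonneg _⟩ (⟨v, hv⟩ : K)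

/-- One accelerated step for a smooth convex function, before any optimality of `z₁` is used. -/
theorem accelerated_step_le [CompleteSpace E] {h : E → ℝ} {h' : E → E} {L A a : ℝ}
    (hc : ConvexOn ℝ Set.univ h) (hh : ∀ w, HasGradientAt h (h' w) w)
    (hL : ∀ u v, ‖h' u - h' v‖ ≤ L * ‖u - v‖) (hA : 0 ≤ A) (ha : 0 < a) {x y z x₁ z₁ : E}
    (hy : y = (A / (A + a)) • x + (a / (A + a)) • z)
    (hx₁ : x₁ = (A / (A + a)) • x + (a / (A + a)) • z₁) :
    (A + a) * h x₁ ≤ A * h x + a * (h y + ⟪h' y, z₁ - y⟫) +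
      L * a ^ 2 / (2 * (A + a)) * ‖z₁ - z‖ ^ 2 := by
  have hpos : 0 < A + a := by positivity
  have hdiff : x₁ - y = (a / (A + a)) • (z₁ - z) := by
    rw [hx₁, hy, smul_sub]; abel
  have hcomb : (A + a) • (x₁ - y) = A • (x - y) + a • (z₁ - y) := by
    rw [smul_sub, hx₁, smul_add, smul_smul, smul_smul, mul_div_cancel₀ _ hpos.ne',
      mul_div_cancel₀ _ hpos.ne', add_smul, smul_sub, smul_sub]
    abel
  have hin := congrArg (fun p => ⟪h' y, p⟫) hcomb
  simp only [inner_add_right, real_inner_smul_right] at hin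
  have hdesc := mul_le_mul_of_nonneg_left (le_add_inner_gradient_add_sq hh hL y x₁) hpos.le
  have hquad : (A + a) * (L / 2 * ‖x₁ - y‖ ^ 2) =
      L * a ^ 2 / (2 * (A + a)) * ‖z₁ - z‖ ^ 2 := by
    rw [hdiff, norm_smul, Real.norm_of_nonneg (by positivity)]
    field_simp
  have hconv := mul_le_mul_of_nonneg_left (hc.add_inner_gradient_le hh y x) hA
  linarith

/-- A convex function is bounded below, relative to its minimum over a closed set `K`, by the
distance to `K` times a bound on the gradient over `K`. -/
theorem ConvexOn.neg_mul_infDist_le [ProperSpace E] {h : E → ℝ} {h' : E → E} {K : Set E}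
    (hc : ConvexOn ℝ Set.univ h) (hh : ∀ w, HasGradientAt h (h' w) w) (hK : IsClosed K)
    (hne : K.Nonempty) {m M : ℝ} (hm : ∀ w ∈ K, m ≤ h w) (hM : ∀ w ∈ K, ‖h' w‖ ≤ M) (x : E) :
    -(M * Metric.infDist x K) ≤ h x - m := by
  obtain ⟨p, hpK, hp⟩ := hK.exists_infDist_eq_dist hne x
  have hgrad := hc.add_inner_gradient_le hh p x
  have hcs := neg_le_of_abs_le (abs_real_inner_le_norm (h' p) (x - p))
  have hMp := mul_le_mul_of_nonneg_right (hM p hpK) (norm_nonneg (x - p))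
  rw [hp, dist_eq_norm]
  linarith [hm p hpK]

end Smooth

/-- The condition on the step-size parameter of AGM-BiO absorbs the quadratic error terms. -/
theorem weak_sharp_absorb {F S E D b c α M : ℝ} (hα : 0 < α) (hM : 0 ≤ M)
    (hb : 0 ≤ b) (hbc : 2 * M * b ≤ α * c) (hF : F + c * S ≤ D) (hE : 0 ≤ E) (hD : 0 ≤ D)
    (hFlow : -(M * (E + b * S)) ≤ α * F) : -(2 * M * E) / α - D ≤ F := by
  rcases le_or_gt 0 F with h | h
  · have : -(2 * M * E) / α ≤ 0 := div_nonpos_of_nonpos_of_nonneg (by simp; positivity) hα.le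
    linarith
  · have h1 : 2 * M * b * S ≤ α * (D - F) := by
      rcases le_or_gt 0 S with hS | hS
      · nlinarith [mul_le_mul_of_nonneg_right hbc hS]
      · have : 2 * M * b * S ≤ 0 := mul_nonpos_of_nonneg_of_nonpos (by positivity) hS.le
        nlinarith
    rw [sub_le_iff_le_add, div_le_iff₀ hα]
    nlinarith

theorem agm_bio_weak_sharp_lower_bound
    {n : ℕ} {f g : EuclideanSpace ℝ (Fin n) → ℝ}
    {f' g' : EuclideanSpace ℝ (Fin n) → EuclideanSpace ℝ (Fin n)}
    {Z : Set (EuclideanSpace ℝ (Fin n))}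
    {L_f L_g : ℝ} (hLf : 0 < L_f) (hLg : 0 < L_g)
    (hZconv : Convex ℝ Z) (hZcl : IsClosed Z)
    (hfconv : ConvexOn ℝ Set.univ f) (hgconv : ConvexOn ℝ Set.univ g)
    (hf' : ∀ w, HasGradientAt f (f' w) w)
    (hg' : ∀ w, HasGradientAt g (g' w) w)
    (hLipf : ∀ u v, ‖f' u - f' v‖ ≤ L_f * ‖u - v‖)
    (hLipg : ∀ u v, ‖g' u - g' v‖ ≤ L_g * ‖u - v‖)
    {xstar : EuclideanSpace ℝ (Fin n)}
    (hxZ : xstar ∈ Z)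
    (hxlow : ∀ w ∈ Z, g xstar ≤ g w)
    (hxopt : ∀ w ∈ Z, (∀ u ∈ Z, g w ≤ g u) → f xstar ≤ f w)
    {α : ℝ} (hα : 0 < α)
    (hHEB : ∀ w ∈ Z, α * Metric.infDist w {w ∈ Z | ∀ u ∈ Z, g w ≤ g u} ≤ g w - g xstar)
    {M : ℝ} (hM : IsGreatest ((fun w => ‖f' w‖) '' {w ∈ Z | ∀ u ∈ Z, g w ≤ g u}) M)
    {γ : ℝ} (hγ0 : 0 < γ)
    (hγ1 : γ ≤ min (2 * α * L_f / (2 * M * L_g + α * L_f)) 1)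
    {x z y : ℕ → EuclideanSpace ℝ (Fin n)} {A a gs : ℕ → ℝ}
    (hA0 : A 0 = 0) (hxz0 : x 0 = z 0)
    (ha : ∀ k : ℕ, a k = γ * ((k : ℝ) + 1) / (4 * L_f))
    (hArec : ∀ k, A (k + 1) = A k + a k)
    (hy : ∀ k, y k = (A k / (A k + a k)) • x k + (a k / (A k + a k)) • z k)
    (hgs : ∀ k : ℕ, 0 ≤ gs k - g xstar ∧
        gs k - g xstar ≤ 2 * L_g * ‖x 0 - xstar‖ ^ 2 / ((k : ℝ) + 1) ^ 2)
    (hzmem : ∀ k, z (k + 1) ∈ Z ∧ g (y k) + ⟪g' (y k), z (k + 1) - y k⟫ ≤ gs k)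
    (hzproj : ∀ k, ∀ w ∈ Z, g (y k) + ⟪g' (y k), w - y k⟫ ≤ gs k →
        ‖z (k + 1) - (z k - a k • f' (y k))‖ ≤ ‖w - (z k - a k • f' (y k))‖)
    (hxrec : ∀ k, x (k + 1) = (A k / (A k + a k)) • x k + (a k / (A k + a k)) • z (k + 1)) :
    ∀ k : ℕ, 1 ≤ k →
      f (x k) - f xstar ≥
        -(8 * L_g * ‖x 0 - xstar‖ ^ 2 * M * (Real.log (k : ℝ) + 1) / (α * (k : ℝ) * ((k : ℝ) + 1))) -
          4 * L_f * ‖x 0 - xstar‖ ^ 2 / (γ * (k : ℝ) * ((k : ℝ) + 1)) := by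
  set D := ‖x 0 - xstar‖ with hDdef
  set X := {w ∈ Z | ∀ u ∈ Z, g w ≤ g u} with hX
  obtain ⟨⟨p, hpX, hpM⟩, hMub⟩ := hM
  have hM0 : 0 ≤ M := hpM ▸ norm_nonneg _
  have hXM : ∀ w ∈ X, ‖f' w‖ ≤ M := fun w hw => hMub ⟨w, hw, rfl⟩
  have hgcont : Continuous g :=
    continuous_iff_continuousAt.2 fun w => (hg' w).continuousAt
  have hXcl : IsClosed X := by
    have : X = Z ∩ {w | g w ≤ g xstar} := by
      ext w
      exact ⟨fun hw => ⟨hw.1, hw.2 _ hxZ⟩, fun hw => ⟨hw.1, fun u hu => hw.2.trans (hxlow u hu)⟩⟩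
    rw [this]
    exact hZcl.inter (isClosed_le hgcont continuous_const)
  have hγle1 : γ ≤ 1 := hγ1.trans (min_le_right _ _)
  have hγM : γ * (2 * M * L_g + α * L_f) ≤ 2 * α * L_f :=
    (le_div_iff₀ (by positivity)).1 (hγ1.trans (min_le_left _ _))
  have hapos : ∀ k, 0 < a k := fun k => by rw [ha]; positivity
  have hA : ∀ k : ℕ, A k = γ * (k * (k + 1)) / (8 * L_f) := by
    intro k
    induction k with
    | zero => simp [hA0]
    | succ k ih =>
      rw [hArec, ih, ha]
      push_cast
      field_simp
      ring
  have hAnn : ∀ k, 0 ≤ A k := fun k => by rw [hA]; positivity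
  have hratio : ∀ k, a k ^ 2 / (2 * (A k + a k)) ≤ γ / (4 * L_f) := by
    intro k
    rw [← hArec, hA, ha]
    push_cast
    rw [div_le_div_iff₀ (by positivity) (by positivity)]
    field_simp
    nlinarith
  have hcut : ∀ k, Convex ℝ {w ∈ Z | g (y k) + ⟪g' (y k), w - y k⟫ ≤ gs k} := by
    intro k
    refine hZconv.inter fun u hu v hv s t hs ht hst => ?_
    have hu' := mul_le_mul_of_nonneg_left (show g (y k) + ⟪g' (y k), u - y k⟫ ≤ gs k from hu) hs
    have hv' := mul_le_mul_of_nonneg_left (show g (y k) + ⟪g' (y k), v - y k⟫ ≤ gs k from hv) ht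
    change g (y k) + ⟪g' (y k), s • u + t • v - y k⟫ ≤ gs k
    simp only [inner_sub_right, inner_add_right, real_inner_smul_right] at hu' hv' ⊢
    obtain rfl : t = 1 - s := by linarith
    linarith
  set S : ℕ → ℝ := fun k => ∑ i ∈ Finset.range k, ‖z (i + 1) - z i‖ ^ 2 with hS
  set E : ℕ → ℝ := fun k => ∑ i ∈ Finset.range k, a i * (gs i - g xstar) with hE
  have hxmem : ∀ k, x (k + 1) ∈ Z := by
    intro k
    induction k with
    | zero => simpa [hxrec 0, hA0, (hapos 0).ne'] using (hzmem 0).1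
    | succ k ih =>
      have hpos := add_pos_of_nonneg_of_pos (hAnn (k + 1)) (hapos (k + 1))
      rw [hxrec (k + 1)]
      exact hZconv ih (hzmem (k + 1)).1 (div_nonneg (hAnn _) hpos.le)
        (div_nonneg (hapos _).le hpos.le) (by rw [← add_div, div_self hpos.ne'])
  have hupper : ∀ k, A k * (f (x k) - f xstar) + ‖z k - xstar‖ ^ 2 / 2 +
      (1 / 2 - γ / 4) * S k ≤ D ^ 2 / 2 := by
    intro k
    induction k with
    | zero => simp [hA0, hS, hDdef, hxz0]
    | succ k ih =>
      have hstep := accelerated_step_le hfconv hf' hLipf (hAnn k) (hapos k) (hy k) (hxrec k)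
      have hstar := mul_le_mul_of_nonneg_left
        (hfconv.add_inner_gradient_le hf' (y k) xstar) (hapos k).le
      have hproj := inner_sub_le_zero_of_norm_sub_le (hcut k) (hzmem k)
        (fun w hw => hzproj k w hw.1 hw.2)
        (⟨hxZ, (hgconv.add_inner_gradient_le hg' (y k) xstar).trans (sub_nonneg.1 (hgs k).1)⟩)
      have hpyth : ⟪z k - z (k + 1), xstar - z (k + 1)⟫ =
          (‖z (k + 1) - z k‖ ^ 2 + ‖z (k + 1) - xstar‖ ^ 2 - ‖z k - xstar‖ ^ 2) / 2 := by
        have := norm_sub_sq_real (z k - z (k + 1)) (xstar - z (k + 1))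
        rw [sub_sub_sub_cancel_right, norm_sub_rev (z k) (z (k + 1)),
          norm_sub_rev xstar] at this
        linarith
      rw [sub_right_comm, inner_sub_left, hpyth, real_inner_smul_left] at hproj
      have hcoef := mul_le_mul_of_nonneg_right
        (mul_le_mul_of_nonneg_left (hratio k) hLf.le) (sq_nonneg ‖z (k + 1) - z k‖)
      have hc : L_f * (γ / (4 * L_f)) = γ / 4 := by field_simp
      rw [hc, ← mul_div_assoc] at hcoef
      have hsplit : ⟪f' (y k), xstar - z (k + 1)⟫ =
          ⟪f' (y k), xstar - y k⟫ - ⟪f' (y k), z (k + 1) - y k⟫ := by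
        rw [← inner_sub_right, sub_sub_sub_cancel_right]
      rw [hsplit] at hproj
      have hSs : S (k + 1) = S k + ‖z (k + 1) - z k‖ ^ 2 := Finset.sum_range_succ _ _
      rw [hArec, hSs]
      linarith
  have hlower : ∀ k, A k * (g (x k) - g xstar) ≤ E k + L_g * γ / (4 * L_f) * S k := by
    intro k
    induction k with
    | zero => simp [hA0, hS, hE]
    | succ k ih =>
      have hstep := accelerated_step_le hgconv hg' hLipg (hAnn k) (hapos k) (hy k) (hxrec k)
      have hlin := mul_le_mul_of_nonneg_left (hzmem k).2 (hapos k).le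
      have hcoef := mul_le_mul_of_nonneg_right
        (mul_le_mul_of_nonneg_left (hratio k) hLg.le) (sq_nonneg ‖z (k + 1) - z k‖)
      rw [← mul_div_assoc, ← mul_div_assoc] at hcoef
      have hSs : S (k + 1) = S k + ‖z (k + 1) - z k‖ ^ 2 := Finset.sum_range_succ _ _
      have hEs : E (k + 1) = E k + a k * (gs k - g xstar) := Finset.sum_range_succ _ _
      rw [hArec, hSs, hEs]
      linarith
  have hEnn : ∀ k, 0 ≤ E k := fun k =>
    Finset.sum_nonneg fun i _ => mul_nonneg (hapos i).le (hgs i).1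
  have hElog : ∀ k : ℕ, E k ≤ γ * L_g * D ^ 2 / (2 * L_f) * (Real.log k + 1) := by
    intro k
    have hharm : ((harmonic k : ℚ) : ℝ) ≤ 1 + Real.log k := harmonic_le_one_add_log k
    calc E k ≤ ∑ i ∈ Finset.range k, γ * L_g * D ^ 2 / (2 * L_f) * ((i : ℝ) + 1)⁻¹ := by
          refine Finset.sum_le_sum fun i _ => ?_
          refine (mul_le_mul_of_nonneg_left (hgs i).2 (hapos i).le).trans_eq ?_
          rw [ha]
          field_simp
          norm_num
      _ = γ * L_g * D ^ 2 / (2 * L_f) * (harmonic k : ℚ) := by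
          rw [← Finset.mul_sum]
          simp [harmonic]
      _ ≤ _ := by
          rw [add_comm]
          gcongr
  intro k hk
  have hk0 : (0 : ℝ) < k := by exact_mod_cast hk
  have hApos : 0 < A k := by rw [hA]; positivity
  have hxk : x k ∈ Z := by
    obtain ⟨j, rfl⟩ := Nat.exists_eq_add_of_le' hk
    exact hxmem j
  have hsharp := mul_le_mul_of_nonneg_left (hHEB _ hxk) hM0
  have hdist := mul_le_mul_of_nonneg_left
    (hfconv.neg_mul_infDist_le hf' hXcl ⟨p, hpX⟩ (fun w hw => hxopt w hw.1 hw.2) hXM (x k)) hα.le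
  have hFlow : -(M * (E k + L_g * γ / (4 * L_f) * S k)) ≤ α * (A k * (f (x k) - f xstar)) := by
    have h1 := mul_le_mul_of_nonneg_left (hlower k) hM0
    have h2 : -(M * (g (x k) - g xstar)) ≤ α * (f (x k) - f xstar) := by linarith
    have h3 := mul_le_mul_of_nonneg_left h2 hApos.le
    linarith
  have hmain := weak_sharp_absorb hα hM0 (c := 1 / 2 - γ / 4) (D := D ^ 2 / 2)
    (by positivity) (by
      have : 2 * M * (L_g * γ / (4 * L_f)) = (2 * M * L_g * γ) / (4 * L_f) := by ring
      rw [this, div_le_iff₀ (by positivity)]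
      linarith)
    (by linarith [hupper k, sq_nonneg ‖z k - xstar‖]) (hEnn k) (by positivity) hFlow
  have hEM : 2 * M * E k / α ≤
      2 * M * (γ * L_g * D ^ 2 / (2 * L_f) * (Real.log k + 1)) / α := by
    gcongr
    exact hElog k
  rw [neg_div] at hmain
  refine le_of_mul_le_mul_left (le_trans (le_of_eq ?_) (le_trans
    (sub_le_sub_right (neg_le_neg hEM) (D ^ 2 / 2)) hmain)) hApos
  rw [hA]
  field_simp
  ring
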